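/- arXiv:1903.01978 — 5 statements merged into one kernel-verified Lean document; each statement's English description precedes it below -/
import Mathlib

section
/- Let R be a commutative ring, let x and y be units of R, and let M be an R-module. Define the ternary operation [a,b,c] = x•b + y•c - (x*y)•a on M (the Alexander tribracket operation). Then for all a, b, c, d ∈ M, [c,[a,b,c],[a,c,d]] = [b,[a,b,c],[a,b,d]] = [d,[a,b,d],[a,c,d]]. -/
/-- For a commutative ring `R` with units `x, y` and an `R`-module `M`, the
Alexander tribracket `[a,b,c] = x•b + y•c - (x*y)•a` satisfies the horizontal
tribracket axiom (ii). -/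
theorem alexander_tribracket_axiom_ii (R : Type*) [CommRing R] (M : Type*)
    [AddCommGroup M] [Module R M] (x y : Rˣ)
    (T : M → M → M → M)
    (hT : ∀ a b c : M, T a b c = (x : R) • b + (y : R) • c - ((x : R) * (y : R)) • a)
    (a b c d : M) :
    T c (T a b c) (T a c d) = T b (T a b c) (T a b d) ∧
    T b (T a b c) (T a b d) = T d (T a b d) (T a c d) := by
  simp only [hT]
  constructor <;> module
end

section
/- There are exactly two horizontal tribracket operations on a two-element set. Concretely, a ternary operation T on ℤ/2 is a horizontal tribracket if and only if T(a,b,c) = a + b + c for all a,b,c or T(a,b,c) = a + b + c + 1 for all a,b,c. -/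
/-- An injective self-map of `ℤ/2` is a translation. -/
theorem ZMod.two_eq_add_of_injective {f : ZMod 2 → ZMod 2} (hf : Function.Injective f)
    (z : ZMod 2) : f z = f 0 + z := by
  have h : f 1 ≠ f 0 := hf.ne (by decide)
  have key : ∀ u v : ZMod 2, u ≠ v → u = v + 1 := by decide
  have hz : z = 0 ∨ z = 1 := by revert z; decide
  rcases hz with rfl | rfl
  · exact (add_zero _).symm
  · exact key _ _ h

/-- For either constant `k`, the operation `a + b + c + k` on `ℤ/2` is a horizontal tribracket. -/
theorem ZMod.two_tribracket_add_const (k : ZMod 2) (T : ZMod 2 → ZMod 2 → ZMod 2 → ZMod 2)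
    (hT : ∀ a b c, T a b c = a + b + c + k) :
    (∀ x y : ZMod 2,
        Function.Bijective (fun z => T x y z) ∧
        Function.Bijective (fun z => T x z y) ∧
        Function.Bijective (fun z => T z x y)) ∧
      (∀ a b c d : ZMod 2,
        T c (T a b c) (T a c d) = T b (T a b c) (T a b d) ∧
        T b (T a b c) (T a b d) = T d (T a b d) (T a c d)) := by
  obtain rfl : T = fun a b c => a + b + c + k := by ext a b c : 3; exact hT a b c
  clear hT
  revert k
  decide

/-- A ternary operation `T` on `ℤ/2` is a horizontal tribracket (axioms (i) and
(ii)) if and only if `T a b c = a + b + c` for all `a,b,c` or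
`T a b c = a + b + c + 1` for all `a,b,c`; in particular there are exactly two
horizontal tribracket operations on a two-element set. -/
theorem two_element_tribrackets (T : ZMod 2 → ZMod 2 → ZMod 2 → ZMod 2) :
    ((∀ x y : ZMod 2,
        Function.Bijective (fun z => T x y z) ∧
        Function.Bijective (fun z => T x z y) ∧
        Function.Bijective (fun z => T z x y)) ∧
      (∀ a b c d : ZMod 2,
        T c (T a b c) (T a c d) = T b (T a b c) (T a b d) ∧
        T b (T a b c) (T a b d) = T d (T a b d) (T a c d)))
    ↔ ((∀ a b c : ZMod 2, T a b c = a + b + c) ∨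
       (∀ a b c : ZMod 2, T a b c = a + b + c + 1)) := by
  constructor
  · rintro ⟨hbij, -⟩
    have h : ∀ a b c, T a b c = a + b + c + T 0 0 0 := fun a b c => by
      rw [ZMod.two_eq_add_of_injective (hbij a b).1.injective c,
        ZMod.two_eq_add_of_injective (hbij a 0).2.1.injective b,
        ZMod.two_eq_add_of_injective (hbij 0 0).2.2.injective a]
      ring
    have h0 : ∀ k : ZMod 2, k = 0 ∨ k = 1 := by decide
    rcases h0 (T 0 0 0) with h0 | h0
    · exact .inl fun a b c => by rw [h, h0, add_zero]
    · exact .inr fun a b c => by rw [h, h0]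
  · rintro (h | h)
    · exact ZMod.two_tribracket_add_const 0 T fun a b c => by rw [h, add_zero]
    · exact ZMod.two_tribracket_add_const 1 T h
end

section
/- The set of quadruples (x₁, x₂, x₃, x₄) ∈ (ℤ/5)⁴ satisfying the two equations 3x₁ + x₂ + 2x₄ = x₃ and 3x₁ + 2x₂ + x₄ = x₃ has exactly 25 elements. -/
/-- A coloring is determined by its first two coordinates: the equations amount to
`x₄ = x₂` and `x₃ = 3x₁ + 3x₂`. -/
def hopfLinkColoringEquiv (R : Type*) [CommRing R] :
    {p : R × R × R × R //
      3 * p.1 + p.2.1 + 2 * p.2.2.2 = p.2.2.1 ∧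
      3 * p.1 + 2 * p.2.1 + p.2.2.2 = p.2.2.1} ≃ R × R where
  toFun p := (p.1.1, p.1.2.1)
  invFun q := ⟨(q.1, q.2, 3 * q.1 + 3 * q.2, q.2), by constructor <;> ring⟩
  left_inv := by
    rintro ⟨⟨a, b, c, d⟩, h₁, h₂⟩
    dsimp only at h₁ h₂
    have hd : b = d := by linear_combination h₂ - h₁
    have hc : 3 * a + 3 * b = c := by linear_combination 2 * h₂ - h₁
    subst hd hc
    rfl
  right_inv _ := rfl

/-- The set of quadruples `(x₁,x₂,x₃,x₄) ∈ (ℤ/5)⁴` satisfying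
`3x₁ + x₂ + 2x₄ = x₃` and `3x₁ + 2x₂ + x₄ = x₃` has exactly 25 elements:
the Hopf link has 25 colorings by the Alexander tribracket
`[a,b,c] = 3a + b + 2c` on `ℤ/5`. -/
theorem hopf_link_coloring_count :
    Fintype.card
      {p : ZMod 5 × ZMod 5 × ZMod 5 × ZMod 5 //
        3 * p.1 + p.2.1 + 2 * p.2.2.2 = p.2.2.1 ∧
        3 * p.1 + 2 * p.2.1 + p.2.2.2 = p.2.2.1} = 25 := by
  rw [Fintype.card_congr (hopfLinkColoringEquiv (ZMod 5)), Fintype.card_prod, ZMod.card]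
end

section
/- Let X be a set and let T : X × X × X → X be a horizontal tribracket, i.e. (i) for all x, y ∈ X the maps z ↦ T(x,y,z), z ↦ T(x,z,y), and z ↦ T(z,x,y) are bijections of X, and (ii) for all a, b, c, d ∈ X, T(c,T(a,b,c),T(a,c,d)) = T(b,T(a,b,c),T(a,b,d)) = T(d,T(a,b,d),T(a,c,d)). Let V : X × X × X → X be the ternary operation determined by T(a,b,V(a,b,c)) = c for all a, b, c ∈ X. Then V is a vertical tribracket: (i) for all x, y ∈ X the maps z ↦ V(x,y,z), z ↦ V(x,z,y), and z ↦ V(z,x,y) are bijections of X; and (ii) for all a, b, c, d ∈ X, V(a,b,V(b,c,d)) = V(a,V(a,b,c),V(V(a,b,c),c,d)) and V(V(a,b,c),c,d) = V(V(a,b,V(b,c,d)),V(b,c,d),d). -/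
/-- If `T` is a horizontal tribracket on `X` and `V` is the ternary operation
determined by `T a b (V a b c) = c`, then `V` is a vertical tribracket. -/
theorem induced_vertical_tribracket (X : Type*) (T : X → X → X → X)
    (hTi : ∀ x y : X,
      Function.Bijective (fun z => T x y z) ∧
      Function.Bijective (fun z => T x z y) ∧
      Function.Bijective (fun z => T z x y))
    (hTii : ∀ a b c d : X,
      T c (T a b c) (T a c d) = T b (T a b c) (T a b d) ∧
      T b (T a b c) (T a b d) = T d (T a b d) (T a c d))
    (V : X → X → X → X)
    (hV : ∀ a b c : X, T a b (V a b c) = c) :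
    (∀ x y : X,
      Function.Bijective (fun z => V x y z) ∧
      Function.Bijective (fun z => V x z y) ∧
      Function.Bijective (fun z => V z x y)) ∧
    (∀ a b c d : X,
      V a b (V b c d) = V a (V a b c) (V (V a b c) c d) ∧
      V (V a b c) c d = V (V a b (V b c d)) (V b c d) d) := by
  have unique (a b c z : X) (h : T a b z = c) : V a b c = z :=
    (hTi a b).1.1 ((hV a b c).trans h.symm)
  refine ⟨fun x y => ⟨⟨fun z w h => ?_, fun w => ⟨T x y w, unique _ _ _ _ rfl⟩⟩,
    ⟨fun z w h => ?_, fun w => ?_⟩, ⟨fun z w h => ?_, fun w => ?_⟩⟩, fun a b c d => ?_⟩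
  · have h : V x y z = V x y w := h
    rw [← hV x y z, h, hV]
  · have h : V x z y = V x w y := h
    apply (hTi x (V x w y)).2.1.1
    change T x z (V x w y) = T x w (V x w y)
    rw [hV, ← h, hV]
  · obtain ⟨z, hz⟩ := (hTi x w).2.1.2 y
    exact ⟨z, unique _ _ _ _ hz⟩
  · have h : V z x y = V w x y := h
    apply (hTi x (V w x y)).2.2.1
    change T z x (V w x y) = T w x (V w x y)
    rw [hV, ← h, hV]
  · obtain ⟨z, hz⟩ := (hTi x w).2.2.2 y
    exact ⟨z, unique _ _ _ _ hz⟩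
  · obtain ⟨h₁, h₂⟩ := hTii a b (V a b c) (V a b (V b c d))
    simp only [hV] at h₁ h₂
    rw [unique _ _ _ _ h₁, unique _ _ _ _ h₂.symm]
    exact ⟨(unique _ _ _ _ rfl).symm, rfl⟩
end

section
/- Let X be a set and let V : X × X × X → X be a vertical tribracket, i.e. (i) for all x, y ∈ X the maps z ↦ V(x,y,z), z ↦ V(x,z,y), and z ↦ V(z,x,y) are bijections of X, and (ii) for all a, b, c, d ∈ X, V(a,b,V(b,c,d)) = V(a,V(a,b,c),V(V(a,b,c),c,d)) and V(V(a,b,c),c,d) = V(V(a,b,V(b,c,d)),V(b,c,d),d). Let T : X × X × X → X be the ternary operation determined by V(a,b,T(a,b,c)) = c for all a, b, c ∈ X. Then T is a horizontal tribracket: (i) for all x, y ∈ X the maps z ↦ T(x,y,z), z ↦ T(x,z,y), and z ↦ T(z,x,y) are bijections of X; and (ii) for all a, b, c, d ∈ X, T(c,T(a,b,c),T(a,c,d)) = T(b,T(a,b,c),T(a,b,d)) = T(d,T(a,b,d),T(a,c,d)). -/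
/-- If `V` is a vertical tribracket on `X` and `T` is the ternary operation
determined by `V a b (T a b c) = c`, then `T` is a horizontal tribracket. -/
theorem induced_horizontal_tribracket (X : Type*) (V : X → X → X → X)
    (hVi : ∀ x y : X,
      Function.Bijective (fun z => V x y z) ∧
      Function.Bijective (fun z => V x z y) ∧
      Function.Bijective (fun z => V z x y))
    (hVii : ∀ a b c d : X,
      V a b (V b c d) = V a (V a b c) (V (V a b c) c d) ∧
      V (V a b c) c d = V (V a b (V b c d)) (V b c d) d)
    (T : X → X → X → X)
    (hT : ∀ a b c : X, V a b (T a b c) = c) :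
    (∀ x y : X,
      Function.Bijective (fun z => T x y z) ∧
      Function.Bijective (fun z => T x z y) ∧
      Function.Bijective (fun z => T z x y)) ∧
    (∀ a b c d : X,
      T c (T a b c) (T a c d) = T b (T a b c) (T a b d) ∧
      T b (T a b c) (T a b d) = T d (T a b d) (T a c d)) := by
  have hTV (a b z : X) : T a b (V a b z) = z := (hVi a b).1.1 (hT a b (V a b z))
  refine ⟨fun x y => ⟨?_, ?_, ?_⟩, fun a b c d => ?_⟩
  · exact Function.bijective_iff_has_inverse.2 ⟨V x y, hT x y, hTV x y⟩
  · refine ⟨fun z z' h => (hVi x (T x z y)).2.1.1 ?_, fun w => ?_⟩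
    · have hz' := hT x z' y
      rw [← show T x z y = T x z' y from h] at hz'
      exact (hT x z y).trans hz'.symm
    · obtain ⟨z, rfl⟩ := (hVi x w).2.1.2 y
      exact ⟨z, hTV x z w⟩
  · refine ⟨fun z z' h => (hVi x (T z x y)).2.2.1 ?_, fun w => ?_⟩
    · have hz' := hT z' x y
      rw [← show T z x y = T z' x y from h] at hz'
      exact (hT z x y).trans hz'.symm
    · obtain ⟨z, rfl⟩ := (hVi x w).2.2.2 y
      exact ⟨z, hTV z x w⟩
  · have h := hVii a b (T a b c) (T b (T a b c) (T a b d))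
    simp only [hT] at h
    obtain ⟨h₁, h₂⟩ := h
    have hy : T a c d = V c (T a b c) (T b (T a b c) (T a b d)) :=
      (congrArg (T a c) h₁).trans (hTV a c _)
    constructor
    · rw [hy, hTV]
    · rw [hy, h₂, hTV]
end
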